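/- Norm-convergent Dyson expansion: let E be a complex Banach space and let G, V : E → E be bounded linear maps. Then for every t ≥ 0 the series e^{tG} + Σ_{n=1}^∞ ∫_{0 ≤ t_1 ≤ ⋯ ≤ t_n ≤ t} e^{(t−t_n)G} ∘ V ∘ e^{(t_n−t_{n−1})G} ∘ V ∘ ⋯ ∘ V ∘ e^{t_1 G} dt_1⋯dt_n converges absolutely in operator norm (the n-th term has norm at most ‖V‖^n (t^n/n!) e^{t‖G‖}) and its sum equals e^{t(G+V)}. -/

import Mathlib

noncomputable section
set_option maxHeartbeats 1000000

namespace QMS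

/-- The exponential of a continuous linear endomorphism, defined by its power series. -/
def expCLM {E : Type*} [NormedAddCommGroup E] [NormedSpace ℂ E] (T : E →L[ℂ] E) : E →L[ℂ] E :=
  ∑' k : ℕ, ((k.factorial : ℂ))⁻¹ • T ^ k

/-- The `n`-th term of the Dyson expansion: the iterated integral
`∫_{0≤t₁≤⋯≤t_n≤t} e^{(t−t_n)G} V e^{(t_n−t_{n-1})G} V ⋯ V e^{t₁G} dt₁⋯dt_n`,
written recursively over the outermost time. -/
def dysonTerm {E : Type*} [NormedAddCommGroup E] [NormedSpace ℂ E] [CompleteSpace E]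
    (G V : E →L[ℂ] E) : ℕ → ℝ → (E →L[ℂ] E)
  | 0, t => expCLM (t • G)
  | (n + 1), t => ∫ s in (0:ℝ)..t, (expCLM ((t - s) • G) ∘L V) ∘L dysonTerm G V n s

theorem expCLM_eq {E : Type*} [NormedAddCommGroup E] [NormedSpace ℂ E] (T : E →L[ℂ] E) :
    expCLM T = NormedSpace.exp T := by
  rw [NormedSpace.exp_eq_tsum ℂ]; rfl

theorem norm_expCLM_le {E : Type*} [NormedAddCommGroup E] [NormedSpace ℂ E] (T : E →L[ℂ] E) :
    ‖expCLM T‖ ≤ Real.exp ‖T‖ := by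
  unfold expCLM
  have h : HasSum (fun n : ℕ => ‖T‖ ^ n / (n.factorial : ℝ)) (Real.exp ‖T‖) := by
    rw [Real.exp_eq_exp_ℝ]
    exact NormedSpace.expSeries_div_hasSum_exp ‖T‖
  refine tsum_of_norm_bounded h fun k => ?_
  have hp : ‖T ^ k‖ ≤ ‖T‖ ^ k := by
    rcases Nat.eq_zero_or_pos k with rfl | hk
    · rw [pow_zero, pow_zero]
      exact ContinuousLinearMap.norm_id_le (𝕜 := ℂ) (E := E)
    · exact norm_pow_le' T hk
  rw [norm_smul, norm_inv, Complex.norm_natCast, div_eq_inv_mul]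
  gcongr

theorem norm_expCLM_smul_le {E : Type*} [NormedAddCommGroup E] [NormedSpace ℂ E]
    (T : E →L[ℂ] E) (t : ℝ) (ht : 0 ≤ t) :
    ‖expCLM (t • T)‖ ≤ Real.exp (t * ‖T‖) := by
  refine (norm_expCLM_le _).trans ?_
  rw [norm_smul, Real.norm_of_nonneg ht]

theorem hasDerivAt_expCLM {E : Type*} [NormedAddCommGroup E] [NormedSpace ℂ E]
    [CompleteSpace E] (T : E →L[ℂ] E) (t : ℝ) :
    HasDerivAt (fun u : ℝ => expCLM (u • T)) (expCLM (t • T) * T) t := by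
  simp only [expCLM_eq]
  exact hasDerivAt_exp_smul_const T t

theorem hasDerivAt_expCLM' {E : Type*} [NormedAddCommGroup E] [NormedSpace ℂ E]
    [CompleteSpace E] (T : E →L[ℂ] E) (t : ℝ) :
    HasDerivAt (fun u : ℝ => expCLM (u • T)) (T * expCLM (t • T)) t := by
  simp only [expCLM_eq]
  exact hasDerivAt_exp_smul_const' T t

theorem continuous_expCLM {E : Type*} [NormedAddCommGroup E] [NormedSpace ℂ E]
    [CompleteSpace E] (T : E →L[ℂ] E) :
    Continuous (fun u : ℝ => expCLM (u • T)) :=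
  continuous_iff_continuousAt.2 fun t => (hasDerivAt_expCLM T t).continuousAt

theorem continuous_kernel {E : Type*} [NormedAddCommGroup E] [NormedSpace ℂ E]
    [CompleteSpace E] (G V : E →L[ℂ] E) (f : ℝ → (E →L[ℂ] E)) (hf : Continuous f) :
    Continuous (fun p : ℝ × ℝ => (expCLM ((p.1 - p.2) • G) ∘L V) ∘L f p.2) := by
  have h1 : Continuous (fun p : ℝ × ℝ => expCLM ((p.1 - p.2) • G)) :=
    (continuous_expCLM G).comp (continuous_fst.sub continuous_snd)
  exact (h1.mul continuous_const).mul (hf.comp continuous_snd)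

theorem continuous_kernel' {E : Type*} [NormedAddCommGroup E] [NormedSpace ℂ E]
    [CompleteSpace E] (G V : E →L[ℂ] E) (f : ℝ → (E →L[ℂ] E)) (hf : Continuous f) (t : ℝ) :
    Continuous (fun s : ℝ => (expCLM ((t - s) • G) ∘L V) ∘L f s) := by
  have h1 : Continuous (fun s : ℝ => expCLM ((t - s) • G)) :=
    (continuous_expCLM G).comp (continuous_const.sub continuous_id)
  exact (h1.mul continuous_const).mul hf

theorem continuous_dysonTerm {E : Type*} [NormedAddCommGroup E] [NormedSpace ℂ E]
    [CompleteSpace E] (G V : E →L[ℂ] E) (n : ℕ) : Continuous (dysonTerm G V n) := by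
  induction n with
  | zero => exact continuous_expCLM G
  | succ n ih =>
    exact intervalIntegral.continuous_parametric_intervalIntegral_of_continuous
      (continuous_kernel G V _ ih) continuous_id

theorem iter_bound {E : Type*} [NormedAddCommGroup E] [NormedSpace ℂ E]
    [CompleteSpace E] (G V : E →L[ℂ] E) (f : ℕ → ℝ → (E →L[ℂ] E)) (C T : ℝ)
    (h0 : ∀ t, 0 ≤ t → t ≤ T → ‖f 0 t‖ ≤ C * Real.exp (t * ‖G‖))
    (hs : ∀ n t, f (n + 1) t = ∫ s in (0:ℝ)..t, (expCLM ((t - s) • G) ∘L V) ∘L f n s)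
    (n : ℕ) : ∀ t, 0 ≤ t → t ≤ T →
      ‖f n t‖ ≤ C * (‖V‖ ^ n * (t ^ n / (n.factorial : ℝ)) * Real.exp (t * ‖G‖)) := by
  induction n with
  | zero => intro t h1 h2; simpa using h0 t h1 h2
  | succ n ih =>
    intro t h1 h2
    rw [hs]
    have key : ∀ s ∈ Set.Ioc (0:ℝ) t, ‖(expCLM ((t - s) • G) ∘L V) ∘L f n s‖ ≤
        (C * ‖V‖ ^ (n + 1) / (n.factorial : ℝ) * Real.exp (t * ‖G‖)) * s ^ n := by
      intro s hs'
      have e1 := norm_expCLM_smul_le G (t - s) (by linarith [hs'.2])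
      have e2 := ih s hs'.1.le (hs'.2.trans h2)
      calc ‖(expCLM ((t - s) • G) ∘L V) ∘L f n s‖
          ≤ ‖expCLM ((t - s) • G)‖ * ‖V‖ * ‖f n s‖ :=
            (ContinuousLinearMap.opNorm_comp_le _ _).trans
              (mul_le_mul_of_nonneg_right (ContinuousLinearMap.opNorm_comp_le _ _)
                (norm_nonneg _))
        _ ≤ Real.exp ((t - s) * ‖G‖) * ‖V‖ *
            (C * (‖V‖ ^ n * (s ^ n / (n.factorial : ℝ)) * Real.exp (s * ‖G‖))) := by
            gcongr
        _ = (C * ‖V‖ ^ (n + 1) / (n.factorial : ℝ) *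
              (Real.exp ((t - s) * ‖G‖) * Real.exp (s * ‖G‖))) * s ^ n := by ring
        _ = _ := by rw [← Real.exp_add]; congr 3; ring
    refine (intervalIntegral.norm_integral_le_of_norm_le h1
      (Filter.Eventually.of_forall key)
      ((continuous_const.mul (continuous_pow n)).intervalIntegrable _ _)).trans (le_of_eq ?_)
    rw [intervalIntegral.integral_const_mul, integral_pow, Nat.factorial_succ]
    have : (n.factorial : ℝ) ≠ 0 := by positivity
    have : (n : ℝ) + 1 ≠ 0 := by positivity
    push_cast
    field_simp
    simp

theorem duhamel {E : Type*} [NormedAddCommGroup E] [NormedSpace ℂ E]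
    [CompleteSpace E] (G V : E →L[ℂ] E) (t : ℝ) :
    ∫ s in (0:ℝ)..t, (expCLM ((t - s) • G) ∘L V) ∘L expCLM (s • (G + V)) =
      expCLM (t • (G + V)) - expCLM (t • G) := by
  have hd : ∀ s ∈ Set.uIcc 0 t, HasDerivAt
      (fun s : ℝ => expCLM ((t - s) • G) * expCLM (s • (G + V)))
      ((expCLM ((t - s) • G) ∘L V) ∘L expCLM (s • (G + V))) s := by
    intro s _
    have a : HasDerivAt (fun s : ℝ => expCLM ((t - s) • G)) (-(expCLM ((t - s) • G) * G)) s := by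
      have := (hasDerivAt_expCLM G (t - s)).scomp s ((hasDerivAt_id s).const_sub t)
      exact this.congr_deriv (by simp)
    have b := a.mul (hasDerivAt_expCLM' (G + V) s)
    refine b.congr_deriv ?_
    change _ = expCLM ((t - s) • G) * V * expCLM (s • (G + V))
    noncomm_ring
  rw [intervalIntegral.integral_eq_sub_of_hasDerivAt hd
    ((continuous_kernel' G V _ (continuous_expCLM (G + V)) t).intervalIntegrable _ _)]
  have h0 : expCLM (0 : E →L[ℂ] E) = 1 := by rw [expCLM_eq, NormedSpace.exp_zero]
  simp [h0]

theorem remainder_succ {E : Type*} [NormedAddCommGroup E] [NormedSpace ℂ E]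
    [CompleteSpace E] (G V : E →L[ℂ] E) (N : ℕ) (t : ℝ) :
    expCLM (t • (G + V)) - ∑ n ∈ Finset.range (N + 1), dysonTerm G V n t =
    ∫ s in (0:ℝ)..t, (expCLM ((t - s) • G) ∘L V) ∘L
      (expCLM (s • (G + V)) - ∑ n ∈ Finset.range N, dysonTerm G V n s) := by
  have hk : ∀ s : ℝ, (expCLM ((t - s) • G) ∘L V) ∘L
      (expCLM (s • (G + V)) - ∑ n ∈ Finset.range N, dysonTerm G V n s) =
      (expCLM ((t - s) • G) ∘L V) ∘L expCLM (s • (G + V)) -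
        ∑ n ∈ Finset.range N, (expCLM ((t - s) • G) ∘L V) ∘L dysonTerm G V n s := by
    intro s
    change (expCLM ((t - s) • G) * V) * _ = (expCLM ((t - s) • G) * V) * _ -
      ∑ n ∈ Finset.range N, (expCLM ((t - s) • G) * V) * _
    rw [mul_sub, Finset.mul_sum]
  simp only [hk]
  rw [intervalIntegral.integral_sub, intervalIntegral.integral_finsetSum, duhamel,
    Finset.sum_range_succ']
  · simp only [dysonTerm]
    abel
  · intro n _
    exact (continuous_kernel' G V _ (continuous_dysonTerm G V n) t).intervalIntegrable _ _
  · exact (continuous_kernel' G V _ (continuous_expCLM (G + V)) t).intervalIntegrable _ _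
  · exact (continuous_finsetSum _ fun n _ =>
      continuous_kernel' G V _ (continuous_dysonTerm G V n) t).intervalIntegrable _ _

/-- Norm-convergent Dyson expansion for the exponential of a sum of two bounded
operators on a complex Banach space. -/
theorem dyson_expansion {E : Type*} [NormedAddCommGroup E] [NormedSpace ℂ E]
    [CompleteSpace E] (G V : E →L[ℂ] E) (t : ℝ) (ht : 0 ≤ t) :
    (∀ n : ℕ, 1 ≤ n →
      ‖dysonTerm G V n t‖ ≤ ‖V‖ ^ n * (t ^ n / (n.factorial : ℝ)) * Real.exp (t * ‖G‖)) ∧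
    Summable (fun n : ℕ => ‖dysonTerm G V n t‖) ∧
    HasSum (fun n : ℕ => dysonTerm G V n t) (expCLM (t • (G + V))) := by
  have hb : ∀ n : ℕ,
      ‖dysonTerm G V n t‖ ≤ ‖V‖ ^ n * (t ^ n / (n.factorial : ℝ)) * Real.exp (t * ‖G‖) := by
    intro n
    have := iter_bound G V (dysonTerm G V) 1 t
      (fun s h1 _ => by rw [one_mul]; exact norm_expCLM_smul_le G s h1)
      (fun _ _ => rfl) n t ht le_rfl
    rwa [one_mul] at this
  have hsb : Summable (fun n : ℕ =>
      ‖V‖ ^ n * (t ^ n / (n.factorial : ℝ)) * Real.exp (t * ‖G‖)) := by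
    refine Summable.mul_right _ ((Real.summable_pow_div_factorial (‖V‖ * t)).congr fun n => ?_)
    rw [mul_pow, mul_div_assoc]
  have hsum : Summable (fun n : ℕ => ‖dysonTerm G V n t‖) :=
    Summable.of_nonneg_of_le (fun _ => norm_nonneg _) hb hsb
  refine ⟨fun n _ => hb n, hsum, ?_⟩
  have hR := fun n => iter_bound G V
    (fun N s => expCLM (s • (G + V)) - ∑ n ∈ Finset.range N, dysonTerm G V n s)
    (Real.exp (t * ‖V‖)) t
    (fun s h1 h2 => by
      simp only [Finset.range_zero, Finset.sum_empty, sub_zero]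
      refine (norm_expCLM_smul_le (G + V) s h1).trans ?_
      rw [← Real.exp_add]
      apply Real.exp_le_exp.2
      have := norm_add_le G V
      nlinarith [norm_nonneg V, mul_le_mul_of_nonneg_left this h1,
        mul_le_mul_of_nonneg_right h2 (norm_nonneg V)])
    (fun N s => remainder_succ G V N s) n t ht le_rfl
  rw [hsum.of_norm.hasSum_iff_tendsto_nat]
  have h0 := (hsb.mul_left (Real.exp (t * ‖V‖))).tendsto_atTop_zero
  rw [tendsto_iff_norm_sub_tendsto_zero]
  refine squeeze_zero (fun _ => norm_nonneg _) (fun n => ?_) h0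
  rw [norm_sub_rev]
  exact hR n

end QMS
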